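/- Let α be a nonzero real number, let U ⊆ ℝ × (0,∞) be open, and let u : ℝ × ℝ → ℝ be twice continuously differentiable on U and satisfy the equivariant Faddeev equation on U. Then on U one has the local energy conservation law ∂ₜ[ (1/2)·r·( A₁·((∂ₜu)² + (∂ᵣu)²) + r⁻²sin²u ) ] = ∂ᵣ[ r·A₁·(∂ₜu)·(∂ᵣu) ]. -/

import Mathlib

/-- Partial derivative in the first (time) variable. -/
noncomputable def pdt (w : ℝ × ℝ → ℝ) : ℝ × ℝ → ℝ :=
  fun p => deriv (fun t => w (t, p.2)) p.1

/-- Partial derivative in the second (radial) variable. -/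
noncomputable def pdr (w : ℝ × ℝ → ℝ) : ℝ × ℝ → ℝ :=
  fun p => deriv (fun r => w (p.1, r)) p.2

theorem DifferentiableAt.hasDerivAt_pdt {w : ℝ × ℝ → ℝ} {p : ℝ × ℝ}
    (h : DifferentiableAt ℝ w p) : HasDerivAt (fun t => w (t, p.2)) (pdt w p) p.1 := by
  have h₁ : DifferentiableAt ℝ (fun t : ℝ => w (t, p.2)) p.1 :=
    DifferentiableAt.comp (g := w) p.1 h (by fun_prop)
  exact h₁.hasDerivAt

theorem DifferentiableAt.hasDerivAt_pdr {w : ℝ × ℝ → ℝ} {p : ℝ × ℝ}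
    (h : DifferentiableAt ℝ w p) : HasDerivAt (fun r => w (p.1, r)) (pdr w p) p.2 := by
  have h₁ : DifferentiableAt ℝ (fun r : ℝ => w (p.1, r)) p.2 :=
    DifferentiableAt.comp (g := w) p.2 h (by fun_prop)
  exact h₁.hasDerivAt

theorem DifferentiableAt.pdt_eq_fderiv {w : ℝ × ℝ → ℝ} {p : ℝ × ℝ}
    (h : DifferentiableAt ℝ w p) : pdt w p = fderiv ℝ w p (1, 0) :=
  (HasFDerivAt.comp_hasDerivAt (l := w) p.1 h.hasFDerivAt
    ((hasDerivAt_id p.1).prodMk (hasDerivAt_const p.1 p.2))).deriv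

theorem DifferentiableAt.pdr_eq_fderiv {w : ℝ × ℝ → ℝ} {p : ℝ × ℝ}
    (h : DifferentiableAt ℝ w p) : pdr w p = fderiv ℝ w p (0, 1) :=
  (HasFDerivAt.comp_hasDerivAt (l := w) p.2 h.hasFDerivAt
    ((hasDerivAt_const p.2 p.1).prodMk (hasDerivAt_id p.2))).deriv

section ContDiffAt

variable {u : ℝ × ℝ → ℝ} {p : ℝ × ℝ}

theorem ContDiffAt.pdt_eventuallyEq (h : ContDiffAt ℝ 2 u p) :
    pdt u =ᶠ[nhds p] fun q => fderiv ℝ u q (1, 0) :=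
  (h.eventually (by simp)).mono fun _ hq => (hq.differentiableAt (by simp)).pdt_eq_fderiv

theorem ContDiffAt.pdr_eventuallyEq (h : ContDiffAt ℝ 2 u p) :
    pdr u =ᶠ[nhds p] fun q => fderiv ℝ u q (0, 1) :=
  (h.eventually (by simp)).mono fun _ hq => (hq.differentiableAt (by simp)).pdr_eq_fderiv

theorem ContDiffAt.differentiableAt_fderiv_of_two (h : ContDiffAt ℝ 2 u p) :
    DifferentiableAt ℝ (fderiv ℝ u) p :=
  (h.fderiv_right (m := 1) (by norm_num)).differentiableAt (by simp)

theorem ContDiffAt.differentiableAt_pdt (h : ContDiffAt ℝ 2 u p) :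
    DifferentiableAt ℝ (pdt u) p :=
  (h.differentiableAt_fderiv_of_two.clm_apply
    (differentiableAt_const _)).congr_of_eventuallyEq h.pdt_eventuallyEq

theorem ContDiffAt.differentiableAt_pdr (h : ContDiffAt ℝ 2 u p) :
    DifferentiableAt ℝ (pdr u) p :=
  (h.differentiableAt_fderiv_of_two.clm_apply
    (differentiableAt_const _)).congr_of_eventuallyEq h.pdr_eventuallyEq

theorem ContDiffAt.pdr_pdt_eq_pdt_pdr (h : ContDiffAt ℝ 2 u p) :
    pdr (pdt u) p = pdt (pdr u) p := by
  have hd := h.differentiableAt_fderiv_of_two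
  rw [h.differentiableAt_pdt.pdr_eq_fderiv, h.differentiableAt_pdr.pdt_eq_fderiv,
    h.pdt_eventuallyEq.fderiv_eq, h.pdr_eventuallyEq.fderiv_eq,
    fderiv_clm_apply hd (differentiableAt_const _),
    fderiv_clm_apply hd (differentiableAt_const _)]
  simpa using (h.isSymmSndFDerivAt (by simp)).eq (0, 1) (1, 0)

end ContDiffAt

/-- Local energy conservation for the equivariant Faddeev equation:
`∂ₜ[(1/2)r(A₁((∂ₜu)²+(∂ᵣu)²) + r⁻²sin²u)] = ∂ᵣ[rA₁(∂ₜu)(∂ᵣu)]` on `U`. -/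
theorem stmt5 (α : ℝ) (hα : α ≠ 0) (U : Set (ℝ × ℝ)) (hU : IsOpen U)
    (hUsub : ∀ p ∈ U, 0 < p.2) (u : ℝ × ℝ → ℝ) (hu : ContDiffOn ℝ 2 u U)
    (A₁ : ℝ × ℝ → ℝ) (hA₁ : ∀ p : ℝ × ℝ, A₁ p = 1 + α ^ 2 * Real.sin (u p) ^ 2 / p.2 ^ 2)
    (hFaddeev : ∀ p ∈ U,
      pdt (pdt u) p - pdr (pdr u) p - p.2⁻¹ * pdr u p
        = -2 * p.2⁻¹ * (1 - (A₁ p)⁻¹) * pdr u p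
          - (p.2 ^ 2)⁻¹ * (A₁ p)⁻¹ * (α ^ 2 * ((pdt u p) ^ 2 - (pdr u p) ^ 2) + 1)
            * Real.sin (u p) * Real.cos (u p)) :
    ∀ p ∈ U,
      pdt (fun q => (1 / 2) * q.2
          * (A₁ q * ((pdt u q) ^ 2 + (pdr u q) ^ 2) + Real.sin (u q) ^ 2 / q.2 ^ 2)) p
        = pdr (fun q => q.2 * A₁ q * pdt u q * pdr u q) p := by
  intro p hp
  have hr : p.2 ≠ 0 := (hUsub p hp).ne'
  have hc : ContDiffAt ℝ 2 u p := hu.contDiffAt (hU.mem_nhds hp)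
  have hd : DifferentiableAt ℝ u p := hc.differentiableAt (by simp)
  have hA : A₁ p ≠ 0 := by
    rw [hA₁]
    positivity
  have hut := hd.hasDerivAt_pdt
  have hur := hd.hasDerivAt_pdr
  have hutt := hc.differentiableAt_pdt.hasDerivAt_pdt
  have hutr := hc.differentiableAt_pdt.hasDerivAt_pdr
  have hurt := hc.differentiableAt_pdr.hasDerivAt_pdt
  have hurr := hc.differentiableAt_pdr.hasDerivAt_pdr
  rw [hc.pdr_pdt_eq_pdt_pdr] at hutr
  have hAt : HasDerivAt (fun t => A₁ (t, p.2))
      (2 * α ^ 2 * Real.sin (u p) * Real.cos (u p) * pdt u p / p.2 ^ 2) p.1 := by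
    simp only [hA₁]
    refine ((((hut.sin.pow 2).const_mul (α ^ 2)).div_const (p.2 ^ 2)).const_add 1).congr_deriv ?_
    norm_num
    ring
  have hAr : HasDerivAt (fun r => A₁ (p.1, r))
      (2 * α ^ 2 * Real.sin (u p) * Real.cos (u p) * pdr u p / p.2 ^ 2
        - 2 * (A₁ p - 1) / p.2) p.2 := by
    simp only [hA₁]
    refine ((((hur.sin.pow 2).const_mul (α ^ 2)).div ((hasDerivAt_id p.2).pow 2)
      (pow_ne_zero 2 hr)).const_add 1).congr_deriv ?_
    simp
    field_simp
  have hL := ((hAt.mul ((hutt.pow 2).add (hurt.pow 2))).add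
    ((hut.sin.pow 2).div_const (p.2 ^ 2))).const_mul (1 / 2 * p.2)
  have hR := (((hasDerivAt_id p.2).mul hAr).mul hutr).mul hurr
  refine hL.deriv.trans (Eq.trans ?_ hR.deriv.symm)
  have hF := hFaddeev p hp
  have hutt_eq : pdt (pdt u) p = pdr (pdr u) p + p.2⁻¹ * pdr u p
      + (-2 * p.2⁻¹ * (1 - (A₁ p)⁻¹) * pdr u p
          - (p.2 ^ 2)⁻¹ * (A₁ p)⁻¹ * (α ^ 2 * ((pdt u p) ^ 2 - (pdr u p) ^ 2) + 1)
            * Real.sin (u p) * Real.cos (u p)) := by linarith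
  simp [hutt_eq]
  field_simp
  ring
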